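/- Let S be a symmetric numerical semigroup with Frobenius number f and multiplicity e = a_1. Then: (1) τ = min{ord(f+1), ord(f+2), …, ord(f+a_1)}; (2) for every nonzero u ∈ S and every α ∈ 𝒜(u), τ = min{g(u), g(f + α)}. -/

import Mathlib

namespace GotoNS

/-- `S` is a numerical semigroup: an additive submonoid of `ℕ` with finite
complement, different from `ℕ` itself. -/
def IsNumericalSemigroup (S : Set ℕ) : Prop :=
  (0 : ℕ) ∈ S ∧ (∀ a b, a ∈ S → b ∈ S → a + b ∈ S) ∧ Sᶜ.Finite ∧ S ≠ Set.univ

/-- The multiplicity `e` of `S`: its smallest nonzero element. -/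
noncomputable def mult (S : Set ℕ) : ℕ := sInf {n | n ∈ S ∧ n ≠ 0}

/-- The Frobenius number `f` of `S`: the largest integer not in `S`. -/
noncomputable def frob (S : Set ℕ) : ℕ := sSup {n | n ∉ S}

/-- The `k`-fold sumset `kM` of `M = S \ {0}` (with `0M = {0}`). -/
def kfold (S : Set ℕ) (k : ℕ) : Set ℕ :=
  {s | ∃ c : Fin k → ℕ, (∀ i, c i ∈ S ∧ c i ≠ 0) ∧ ∑ i, c i = s}

/-- The order of `s`: the largest `k` such that `s` is a sum of `k` nonzero
elements of `S` (`ord 0 = 0`; junk value `0` off `S`). -/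
noncomputable def ordS (S : Set ℕ) (s : ℕ) : ℕ := sSup {k | s ∈ kfold S k}

/-- The Apéry set `Ap(S; n) = {w ∈ S | w - n ∉ S}`. -/
def apery (S : Set ℕ) (n : ℕ) : Set ℕ := {w | w ∈ S ∧ ∀ s ∈ S, s + n ≠ w}

/-- `σ(α) = max {ord w | w ∈ Ap(S; α)}`. -/
noncomputable def sigmaS (S : Set ℕ) (α : ℕ) : ℕ := sSup (ordS S '' apery S α)

/-- `𝒜(u) = {α ∈ {1, …, e} | u - α ∈ S}`. -/
def Aset (S : Set ℕ) (u : ℕ) : Set ℕ :=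
  {α | 1 ≤ α ∧ α ≤ mult S ∧ ∃ s ∈ S, s + α = u}

/-- The Goto number `g(u) = min {σ(α) | α ∈ 𝒜(u)}`. -/
noncomputable def goto (S : Set ℕ) (u : ℕ) : ℕ := sInf (sigmaS S '' Aset S u)

/-- `τ`: the minimal Goto number of a nonzero element of `S`. -/
noncomputable def tau (S : Set ℕ) : ℕ := sInf (goto S '' {u | u ∈ S ∧ u ≠ 0})

/-- `ρ`: the maximal Goto number of a nonzero element of `S`. -/
noncomputable def rho (S : Set ℕ) : ℕ := sSup (goto S '' {u | u ∈ S ∧ u ≠ 0})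

/-- An integer belongs to `S` (viewed inside `ℤ`). -/
def memZ (S : Set ℕ) (z : ℤ) : Prop := ∃ n : ℕ, n ∈ S ∧ (n : ℤ) = z

/-- `T = {z ∈ ℤ \ S | z + u ∈ S for all 0 ≠ u ∈ S}`. -/
def Tset (S : Set ℕ) : Set ℤ :=
  {z | ¬ memZ S z ∧ ∀ u : ℕ, u ∈ S → u ≠ 0 → memZ S (z + (u : ℤ))}

open Classical in
/-- The order of an integer, with the convention `ord z = -1` if `z ∉ S`. -/
noncomputable def ordZ (S : Set ℕ) (z : ℤ) : ℤ :=
  if 0 ≤ z ∧ z.toNat ∈ S then (ordS S z.toNat : ℤ) else -1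

/-- `S` is symmetric: for integers `x + y = f`, exactly one of `x, y` lies in `S`. -/
def IsSymmetricNS (S : Set ℕ) : Prop :=
  ∀ x y : ℤ, x + y = (frob S : ℤ) → (memZ S x ↔ ¬ memZ S y)

/-- `u ⪯ u'` iff `u' - u ∈ S`. -/
def preceq (S : Set ℕ) (u u' : ℕ) : Prop := ∃ s ∈ S, u + s = u'

/-- `u ⪯_M u'` iff `u + s = u'` and `ord u + ord s = ord u'` for some `s ∈ S`. -/
def preceqM (S : Set ℕ) (u u' : ℕ) : Prop :=
  ∃ s ∈ S, u + s = u' ∧ ordS S u + ordS S s = ordS S u'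

/-- `Ap(S) \ {0}`. -/
def apNZ (S : Set ℕ) : Set ℕ := apery S (mult S) \ {0}

/-- Minimal elements of `Ap(S) \ {0}` with respect to `⪯`. -/
def minAp (S : Set ℕ) : Set ℕ := {w | w ∈ apNZ S ∧ ∀ w' ∈ apNZ S, preceq S w' w → w' = w}

/-- Maximal elements of `Ap(S) \ {0}` with respect to `⪯`. -/
def maxAp (S : Set ℕ) : Set ℕ := {w | w ∈ apNZ S ∧ ∀ w' ∈ apNZ S, preceq S w w' → w' = w}

/-- Minimal elements of `Ap(S) \ {0}` with respect to `⪯_M`. -/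
def minApM (S : Set ℕ) : Set ℕ := {w | w ∈ apNZ S ∧ ∀ w' ∈ apNZ S, preceqM S w' w → w' = w}

/-- Maximal elements of `Ap(S) \ {0}` with respect to `⪯_M`. -/
def maxApM (S : Set ℕ) : Set ℕ := {w | w ∈ apNZ S ∧ ∀ w' ∈ apNZ S, preceqM S w w' → w' = w}

/-- `S` is pure if all elements of `maxAp S` have the same order. -/
def IsPure (S : Set ℕ) : Prop := ∀ w ∈ maxAp S, ∀ w' ∈ maxAp S, ordS S w = ordS S w'

/-- `S` is `M`-pure if all elements of `maxApM S` have the same order. -/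
def IsMPure (S : Set ℕ) : Prop := ∀ w ∈ maxApM S, ∀ w' ∈ maxApM S, ordS S w = ordS S w'

/-- `S` is `M`-additive if `ord (u + a₁) = ord u + 1` for all `u ∈ S`. -/
def IsMAdditive (S : Set ℕ) : Prop := ∀ u ∈ S, ordS S (u + mult S) = ordS S u + 1

/-- The reduction number `r = min {k | (k+1)M = a₁ + kM}`. -/
noncomputable def redNum (S : Set ℕ) : ℕ :=
  sInf {k | kfold S (k + 1) = (fun x => mult S + x) '' kfold S k}

/-- The set of minimal generators of `S`: nonzero elements of `S` that are not
sums of two nonzero elements of `S`. -/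
def minGens (S : Set ℕ) : Set ℕ :=
  {a | a ∈ S ∧ a ≠ 0 ∧ ∀ x ∈ S, ∀ y ∈ S, x ≠ 0 → y ≠ 0 → x + y ≠ a}

/-- `δ_w = max {ord w + ord w' | w' ∈ S, w + w' ∈ Ap(S)}`. -/
noncomputable def deltaI (S : Set ℕ) (w : ℕ) : ℕ :=
  sSup ((fun w' => ordS S w + ordS S w') '' {w' | w' ∈ S ∧ w + w' ∈ apery S (mult S)})

/-- `δ = min {δ_w | w ∈ Ap(S)}`. -/
noncomputable def deltaNS (S : Set ℕ) : ℕ := sInf (deltaI S '' apery S (mult S))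

/-- `γ_w = max {ord w + ⌊w'/a₁⌋ | w' ∈ S, w + w' ∈ Ap(S)}`. -/
noncomputable def gammaI (S : Set ℕ) (w : ℕ) : ℕ :=
  sSup ((fun w' => ordS S w + w' / mult S) '' {w' | w' ∈ S ∧ w + w' ∈ apery S (mult S)})

/-- `γ = min {γ_w | w ∈ Ap(S)}`. -/
noncomputable def gammaNS (S : Set ℕ) : ℕ := sInf (gammaI S '' apery S (mult S))

/-- `ord(C) = min {ord (f+1), …, ord (f+a₁)}`. -/
noncomputable def ordC (S : Set ℕ) : ℕ :=
  sInf ((fun α => ordS S (frob S + α)) '' Set.Icc 1 (mult S))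


namespace IsNumericalSemigroup

variable {S : Set ℕ}

theorem bddAbove_gaps (hS : IsNumericalSemigroup S) : BddAbove {n | n ∉ S} :=
  Set.Finite.bddAbove hS.2.2.1

theorem mem_of_frob_lt (hS : IsNumericalSemigroup S) {n : ℕ} (hn : frob S < n) : n ∈ S := by
  by_contra h
  exact absurd (le_csSup hS.bddAbove_gaps h) (not_le.mpr hn)

theorem mult_mem (hS : IsNumericalSemigroup S) : mult S ∈ S ∧ mult S ≠ 0 :=
  Nat.sInf_mem (s := {n | n ∈ S ∧ n ≠ 0})
    ⟨frob S + 1, hS.mem_of_frob_lt (Nat.lt_succ_self _), Nat.succ_ne_zero _⟩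

theorem Aset_nonempty (hS : IsNumericalSemigroup S) {u : ℕ} (hu : u ≠ 0) :
    (Aset S u).Nonempty := by
  have hfin : {s | s ∈ S ∧ s < u}.Finite := (Set.finite_Iio u).subset fun _ h => h.2
  obtain ⟨s, ⟨hs, hsu⟩, hmax⟩ :=
    hfin.exists_maximal ⟨0, hS.1, Nat.pos_of_ne_zero hu⟩
  have hmult := hS.mult_mem
  have hle : u ≤ s + mult S := by
    by_contra h
    have := hmax ⟨hS.2.1 _ _ hs hmult.1, not_le.mp h⟩ (Nat.le_add_right _ _)
    have := hmult.2
    omega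
  exact ⟨u - s, by omega, by omega, s, hs, by omega⟩

end IsNumericalSemigroup

theorem mult_le {S : Set ℕ} {n : ℕ} (hn : n ∈ S) (h0 : n ≠ 0) : mult S ≤ n :=
  Nat.sInf_le ⟨hn, h0⟩

theorem le_of_mem_kfold {S : Set ℕ} {s k : ℕ} (h : s ∈ kfold S k) : k ≤ s := by
  obtain ⟨c, hc, rfl⟩ := h
  calc k = ∑ _i : Fin k, 1 := by simp
    _ ≤ ∑ i, c i := Finset.sum_le_sum fun i _ => Nat.one_le_iff_ne_zero.mpr (hc i).2

theorem le_ordS {S : Set ℕ} {s k : ℕ} (h : s ∈ kfold S k) : k ≤ ordS S s :=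
  le_csSup ⟨s, fun _ => le_of_mem_kfold⟩ h

theorem ordS_le_ordS_add {S : Set ℕ} (w : ℕ) {t : ℕ} (ht : t ∈ S) :
    ordS S w ≤ ordS S (w + t) := by
  rcases eq_or_ne t 0 with rfl | h0
  · rfl
  refine csSup_le' fun k hk => ?_
  obtain ⟨c, hc, rfl⟩ := hk
  refine (Nat.le_succ k).trans (le_ordS ⟨Fin.snoc c t, fun i => ?_, ?_⟩)
  · refine Fin.lastCases ?_ (fun j => ?_) i
    · simpa using ⟨ht, h0⟩
    · simpa using hc j
  · simp [Fin.sum_univ_castSucc]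

section Symmetric

variable {S : Set ℕ}

theorem IsSymmetricNS.mem_apery_iff (hsym : IsSymmetricNS S) {w α : ℕ} :
    w ∈ apery S α ↔ w ∈ S ∧ ∃ t ∈ S, w + t = frob S + α := by
  have h := hsym ((frob S : ℤ) + α - w) (w - α) (by ring)
  refine and_congr_right fun _ => ?_
  constructor
  · intro hw
    obtain ⟨t, ht, hte⟩ := h.mpr fun ⟨n, hn, hne⟩ => hw n hn (by omega)
    exact ⟨t, ht, by omega⟩
  · rintro ⟨t, ht, hte⟩ s hs rfl
    exact h.mp ⟨t, ht, by omega⟩ ⟨s, hs, by omega⟩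

theorem sigmaS_eq_ordS (hS : IsNumericalSemigroup S) (hsym : IsSymmetricNS S) {α : ℕ}
    (hα : 1 ≤ α) : sigmaS S α = ordS S (frob S + α) := by
  have hle : ∀ n ∈ ordS S '' apery S α, n ≤ ordS S (frob S + α) := by
    rintro _ ⟨w, hw, rfl⟩
    obtain ⟨-, t, ht, hte⟩ := hsym.mem_apery_iff.mp hw
    exact hte ▸ ordS_le_ordS_add w ht
  refine le_antisymm (csSup_le' hle) (le_csSup ⟨_, hle⟩ ⟨_, ?_, rfl⟩)
  exact hsym.mem_apery_iff.mpr ⟨hS.mem_of_frob_lt (by omega), 0, hS.1, rfl⟩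

theorem mem_Aset_frob_add (hsym : IsSymmetricNS S) {α β : ℕ} (hα : 1 ≤ α)
    (hβ : β ∈ Set.Icc 1 (mult S)) (hne : β ≠ α) : β ∈ Aset S (frob S + α) := by
  obtain ⟨t, ht, hte⟩ := (hsym ((frob S : ℤ) + α - β) (β - α) (by ring)).mpr (by
    rintro ⟨n, hn, hnz⟩
    have := mult_le hn (by omega)
    have := hβ.2
    omega)
  exact ⟨hβ.1, hβ.2, t, ht, by omega⟩

theorem goto_le {u α : ℕ} (hα : α ∈ Aset S u) : goto S u ≤ sigmaS S α :=
  Nat.sInf_le ⟨α, hα, rfl⟩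

theorem exists_goto_eq (hS : IsNumericalSemigroup S) {u : ℕ} (hu : u ≠ 0) :
    ∃ α ∈ Aset S u, sigmaS S α = goto S u :=
  Nat.sInf_mem ((hS.Aset_nonempty hu).image _)

theorem tau_le {u : ℕ} (hu : u ∈ S) (h0 : u ≠ 0) : tau S ≤ goto S u :=
  Nat.sInf_le ⟨u, ⟨hu, h0⟩, rfl⟩

theorem exists_tau_eq (hS : IsNumericalSemigroup S) :
    ∃ α ∈ Set.Icc 1 (mult S), sigmaS S α = tau S := by
  obtain ⟨u, ⟨-, h0⟩, hu⟩ : tau S ∈ goto S '' {u | u ∈ S ∧ u ≠ 0} :=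
    Nat.sInf_mem (Set.Nonempty.image _ ⟨mult S, hS.mult_mem⟩)
  obtain ⟨α, hα, h⟩ := exists_goto_eq hS h0
  exact ⟨α, ⟨hα.1, hα.2.1⟩, h.trans hu⟩

theorem tau_le_sigmaS (hS : IsNumericalSemigroup S) {α : ℕ} (hα : α ∈ Set.Icc 1 (mult S)) :
    tau S ≤ sigmaS S α :=
  (tau_le (u := frob S + 1 + α) (hS.mem_of_frob_lt (by omega)) (by omega)).trans
    (goto_le ⟨hα.1, hα.2, frob S + 1, hS.mem_of_frob_lt (by omega), rfl⟩)

end Symmetric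

/-- for symmetric `S`,
`τ = min {ord (f+1), …, ord (f+a₁)}` and `τ = min (g u) (g (f + α))` for `α ∈ 𝒜(u)`. -/
theorem statement5 (S : Set ℕ) (hS : IsNumericalSemigroup S) (hsym : IsSymmetricNS S) :
    tau S = sInf ((fun α => ordS S (frob S + α)) '' Set.Icc 1 (mult S)) ∧
    (∀ u ∈ S, u ≠ 0 → ∀ α ∈ Aset S u, tau S = min (goto S u) (goto S (frob S + α))) := by
  constructor
  · obtain ⟨α, hα, h⟩ := exists_tau_eq hS
    refine le_antisymm (le_csInf (Set.Nonempty.image _ ⟨α, hα⟩) ?_) (Nat.sInf_le ⟨α, hα, ?_⟩)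
    · rintro _ ⟨β, hβ, rfl⟩
      exact (tau_le_sigmaS hS hβ).trans_eq (sigmaS_eq_ordS hS hsym hβ.1)
    · exact (sigmaS_eq_ordS hS hsym hα.1).symm.trans h
  · intro u hu h0 α hα
    have hα1 := hα.1
    refine le_antisymm
      (le_min (tau_le hu h0) (tau_le (hS.mem_of_frob_lt (by omega)) (by omega))) ?_
    obtain ⟨β, hβ, h⟩ := exists_tau_eq hS
    rw [← h]
    rcases eq_or_ne β α with rfl | hne
    · exact (min_le_left _ _).trans (goto_le hα)
    · exact (min_le_right _ _).trans (goto_le (mem_Aset_frob_add hsym hα1 hβ hne))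

end GotoNS
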